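/- (Multiplicity-2 step of the Bratteli diagram.) For every natural number n, there exist closed subspaces K₁ and K₂ of W_n, each invariant under every x ∈ 𝔐_n, such that K₁ and K₂ are mutually orthogonal, K₁ + K₂ = W_n, and for each j ∈ {1, 2} there is a unitary U_j : V_n → K_j intertwining the 𝔐_n-actions, i.e. x (U_j ξ) = U_j (x ξ) for every x ∈ 𝔐_n and every ξ ∈ V_n. In other words, as a representation of 𝔐_n, W_n is unitarily equivalent to V_n ⊕ V_n. -/

import Mathlib

noncomputable section

open ContinuousLinearMap
open scoped InnerProductSpace ComplexOrder

/-- The discrete monotone Fock space: `ℓ²` over the finite subsets of `ℤ`. -/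
abbrev MF : Type := lp (fun _ : Finset ℤ => ℂ) 2

/-- The canonical orthonormal basis vector corresponding to a finite subset `S ⊆ ℤ`;
`eS ∅` is the vacuum vector `Ω`. -/
noncomputable def eS (S : Finset ℤ) : MF := lp.single 2 S 1

/-- `a : ℤ → MF →L[ℂ] MF` is the family of monotone annihilation operators:
`a i (eS S) = eS (S \ {i})` if `S` is nonempty with `min S = i`, and `a i (eS S) = 0`
otherwise.  The creation operator `a_i†` is the Hilbert-space adjoint of `a i`. -/
def IsMonotoneAnnihilation (a : ℤ → MF →L[ℂ] MF) : Prop :=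
  ∀ (i : ℤ) (S : Finset ℤ),
    (S.min = (i : WithBot ℤ) → a i (eS S) = eS (S.erase i)) ∧
    (S.min ≠ (i : WithBot ℤ) → a i (eS S) = 0)

/-- `𝔐_n`: the unital C*-subalgebra of `B(F)` generated by `{a_i : -n ≤ i ≤ n}`. -/
noncomputable def MonMn (a : ℤ → MF →L[ℂ] MF) (n : ℕ) : StarSubalgebra ℂ (MF →L[ℂ] MF) :=
  (StarAlgebra.adjoin ℂ {x | ∃ i : ℤ, -(n : ℤ) ≤ i ∧ i ≤ (n : ℤ) ∧ x = a i}).topologicalClosure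

/-- `𝔠_n`: the unital C*-subalgebra of `B(F)` generated by `{a_i : -n ≤ i ≤ n+1}`. -/
noncomputable def MonCn (a : ℤ → MF →L[ℂ] MF) (n : ℕ) : StarSubalgebra ℂ (MF →L[ℂ] MF) :=
  (StarAlgebra.adjoin ℂ
    {x | ∃ i : ℤ, -(n : ℤ) ≤ i ∧ i ≤ (n : ℤ) + 1 ∧ x = a i}).topologicalClosure

/-- `V_n`: the closed linear span of the basis vectors `e_S` with `S ⊆ {-n, …, n}`. -/
noncomputable def Vn (n : ℕ) : Submodule ℂ MF :=
  (Submodule.span ℂ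
    {v : MF | ∃ S : Finset ℤ, S ⊆ Finset.Icc (-(n : ℤ)) (n : ℤ) ∧ v = eS S}).topologicalClosure

/-- `W_n`: the closed linear span of the basis vectors `e_S` with `S ⊆ {-n, …, n+1}`. -/
noncomputable def Wn (n : ℕ) : Submodule ℂ MF :=
  (Submodule.span ℂ
    {v : MF | ∃ S : Finset ℤ,
      S ⊆ Finset.Icc (-(n : ℤ)) ((n : ℤ) + 1) ∧ v = eS S}).topologicalClosure

theorem inner_eS_left (S : Finset ℤ) (f : MF) : ⟪eS S, f⟫_ℂ = f S := by
  simp [eS, lp.inner_single_left]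

theorem eS_apply (S T : Finset ℤ) : (eS S : MF) T = if T = S then 1 else 0 := by
  simp [eS, lp.single_apply, Pi.single_apply]

theorem inner_eS_eS (S T : Finset ℤ) : ⟪eS S, eS T⟫_ℂ = if S = T then 1 else 0 := by
  rw [inner_eS_left, eS_apply]

theorem orthonormal_eS : Orthonormal ℂ eS :=
  orthonormal_iff_ite.2 fun S T => inner_eS_eS S T

theorem min_eq_coe_iff (S : Finset ℤ) (i : ℤ) :
    S.min = (i : WithTop ℤ) ↔ i ∈ S ∧ ∀ j ∈ S, i ≤ j := by
  refine ⟨fun h => ⟨Finset.mem_of_min h, fun j hj => Finset.min_le_of_eq hj h⟩, ?_⟩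
  rintro ⟨hi, h⟩
  obtain ⟨m, hm⟩ := Finset.min_of_mem hi
  rw [hm, le_antisymm (Finset.min_le_of_eq hi hm) (h m (Finset.mem_of_min hm))]

theorem IsMonotoneAnnihilation.apply_eS {a : ℤ → MF →L[ℂ] MF} (ha : IsMonotoneAnnihilation a)
    (i : ℤ) (S : Finset ℤ) :
    a i (eS S) = if i ∈ S ∧ ∀ j ∈ S, i ≤ j then eS (S.erase i) else 0 := by
  split_ifs with h
  · exact (ha i S).1 ((min_eq_coe_iff S i).2 h)
  · exact (ha i S).2 fun h' => h ((min_eq_coe_iff S i).1 h')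

theorem IsMonotoneAnnihilation.star_apply_eS {a : ℤ → MF →L[ℂ] MF}
    (ha : IsMonotoneAnnihilation a) (i : ℤ) (S : Finset ℤ) :
    star (a i) (eS S) = if ∀ j ∈ S, i < j then eS (insert i S) else 0 := by
  ext T
  rw [← inner_eS_left, star_eq_adjoint, adjoint_inner_right, ha.apply_eS]
  have key : ((i ∈ T ∧ ∀ j ∈ T, i ≤ j) ∧ T.erase i = S) ↔
      ((∀ j ∈ S, i < j) ∧ T = insert i S) := by
    constructor
    · rintro ⟨⟨hi, hle⟩, rfl⟩
      refine ⟨fun j hj => ?_, (Finset.insert_erase hi).symm⟩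
      exact lt_of_le_of_ne (hle j (Finset.mem_of_mem_erase hj)) (Finset.ne_of_mem_erase hj).symm
    · rintro ⟨hlt, rfl⟩
      refine ⟨⟨Finset.mem_insert_self i S, fun j hj => ?_⟩,
        Finset.erase_insert fun hi => lt_irrefl i (hlt i hi)⟩
      rcases Finset.mem_insert.1 hj with rfl | hj
      exacts [le_rfl, (hlt j hj).le]
  have hl : ⟪(if i ∈ T ∧ ∀ j ∈ T, i ≤ j then eS (T.erase i) else 0 : MF), eS S⟫_ℂ =
      if (i ∈ T ∧ ∀ j ∈ T, i ≤ j) ∧ T.erase i = S then 1 else 0 := by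
    by_cases h : i ∈ T ∧ ∀ j ∈ T, i ≤ j
    · rw [if_pos h, inner_eS_eS, if_congr (and_iff_right h) rfl rfl]
    · rw [if_neg h, inner_zero_left, if_neg fun h' => h h'.1]
  have hr : (if ∀ j ∈ S, i < j then eS (insert i S) else 0 : MF) T =
      if (∀ j ∈ S, i < j) ∧ T = insert i S then 1 else 0 := by
    by_cases h : ∀ j ∈ S, i < j
    · rw [if_pos h, eS_apply, if_congr (and_iff_right h) rfl rfl]
    · rw [if_neg h, if_neg fun h' => h h'.1, lp.coeFn_zero, Pi.zero_apply]
  rw [hl, hr, if_congr key rfl rfl]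

/-- The span of the basis vectors `eS S` with `S ⊆ I`. -/
def fockSpan (I : Finset ℤ) : Submodule ℂ MF :=
  Submodule.span ℂ (Set.range fun S : I.powerset => eS S)

instance (I : Finset ℤ) : FiniteDimensional ℂ (fockSpan I) :=
  FiniteDimensional.span_of_finite ℂ (Set.finite_range _)

theorem eS_mem_fockSpan {I S : Finset ℤ} (h : S ⊆ I) : eS S ∈ fockSpan I :=
  Submodule.subset_span ⟨⟨S, Finset.mem_powerset.2 h⟩, rfl⟩

theorem topologicalClosure_span_eS (I : Finset ℤ) :
    (Submodule.span ℂ {v : MF | ∃ S : Finset ℤ, S ⊆ I ∧ v = eS S}).topologicalClosure =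
      fockSpan I := by
  have h : {v : MF | ∃ S : Finset ℤ, S ⊆ I ∧ v = eS S} =
      Set.range fun S : I.powerset => eS S := by
    ext v
    simp [eq_comm]
  rw [h]
  exact (fockSpan I).closed_of_finiteDimensional.submodule_topologicalClosure_eq

/-- The basis vectors `eS S` with `S ⊆ I`, as a basis of their span. -/
def fockBasis (I : Finset ℤ) : Module.Basis I.powerset ℂ (fockSpan I) :=
  Module.Basis.span (orthonormal_eS.comp _ Subtype.val_injective).linearIndependent

theorem coe_fockBasis (I : Finset ℤ) (S : I.powerset) : (fockBasis I S : MF) = eS S :=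
  congrArg Subtype.val (Module.Basis.span_apply _ S)

theorem orthonormal_fockBasis (I : Finset ℤ) : Orthonormal ℂ (fockBasis I) := by
  classical
  refine orthonormal_iff_ite.2 fun S T => ?_
  rw [Submodule.coe_inner, coe_fockBasis, coe_fockBasis, inner_eS_eS]
  simp only [Subtype.ext_iff]

theorem orthonormal_eS_union {I E : Finset ℤ} (h : Disjoint I E) :
    Orthonormal ℂ fun S : I.powerset => eS (S ∪ E) := by
  refine orthonormal_eS.comp (fun S : I.powerset => (S : Finset ℤ) ∪ E) fun S T hST => ?_
  have hS := h.mono_left (Finset.mem_powerset.1 S.2)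
  have hT := h.mono_left (Finset.mem_powerset.1 T.2)
  refine Subtype.ext ?_
  rw [← Finset.union_sdiff_cancel_right hS, ← Finset.union_sdiff_cancel_right hT]
  exact congrArg (· \ E) hST

/-- The isometry sending `eS S` to `eS (S ∪ E)` for `S ⊆ I`. -/
def unionIsometry {I E : Finset ℤ} (h : Disjoint I E) : fockSpan I →ₗᵢ[ℂ] MF :=
  ((fockBasis I).constr ℂ fun S => eS (S ∪ E)).isometryOfOrthonormal (orthonormal_fockBasis I) (by
    convert orthonormal_eS_union h using 1
    ext1 S
    exact Module.Basis.constr_basis _ _ _ _)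

theorem unionIsometry_apply {I E S : Finset ℤ} (h : Disjoint I E) (hS : S ⊆ I) :
    unionIsometry h ⟨eS S, eS_mem_fockSpan hS⟩ = eS (S ∪ E) := by
  have : fockBasis I ⟨S, Finset.mem_powerset.2 hS⟩ = ⟨eS S, eS_mem_fockSpan hS⟩ :=
    Subtype.ext (coe_fockBasis I _)
  rw [← this]
  exact Module.Basis.constr_basis (fockBasis I) ℂ (fun S => eS (S ∪ E)) _

theorem range_unionIsometry {I E : Finset ℤ} (h : Disjoint I E) :
    (unionIsometry h).range = Submodule.span ℂ (Set.range fun S : I.powerset => eS (S ∪ E)) :=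
  (fockBasis I).constr_range ℂ

/-- `x` leaves `V` invariant and commutes with `J` on `V`. -/
def Intertwines (V : Submodule ℂ MF) (J x : MF →L[ℂ] MF) : Prop :=
  ∀ v ∈ V, x v ∈ V ∧ x (J v) = J (x v)

theorem isClosed_setOf_intertwines {V : Submodule ℂ MF} (hV : IsClosed (V : Set MF))
    (J : MF →L[ℂ] MF) : IsClosed {x | Intertwines V J x} := by
  simp only [Intertwines, Set.ofPred_forall, Set.ofPred_and]
  refine isClosed_iInter fun v => isClosed_iInter fun _ => ?_
  exact (hV.preimage (by fun_prop : Continuous fun x : MF →L[ℂ] MF => x v)).inter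
    (isClosed_eq (by fun_prop) (by fun_prop))

theorem intertwines_of_mem_closure_adjoin {V : Submodule ℂ MF} (hV : IsClosed (V : Set MF))
    {J : MF →L[ℂ] MF} {s : Set (MF →L[ℂ] MF)} (hs : ∀ x ∈ s, Intertwines V J x)
    (hs' : ∀ x ∈ s, Intertwines V J (star x)) {x : MF →L[ℂ] MF}
    (hx : x ∈ (StarAlgebra.adjoin ℂ s).topologicalClosure) : Intertwines V J x := by
  refine closure_minimal (fun y hy => ?_) (isClosed_setOf_intertwines hV J) hx
  have hscal (r : ℂ) : Intertwines V J (algebraMap ℂ (MF →L[ℂ] MF) r) := fun v hv => by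
    simpa [Algebra.algebraMap_eq_smul_one] using V.smul_mem r hv
  have hadd {x y : MF →L[ℂ] MF} (hx : Intertwines V J x) (hy : Intertwines V J y) :
      Intertwines V J (x + y) := fun v hv =>
    ⟨V.add_mem (hx v hv).1 (hy v hv).1, by simp [(hx v hv).2, (hy v hv).2]⟩
  have hmul {x y : MF →L[ℂ] MF} (hx : Intertwines V J x) (hy : Intertwines V J y) :
      Intertwines V J (x * y) := fun v hv =>
    ⟨(hx _ (hy v hv).1).1, by simp [(hx _ (hy v hv).1).2, (hy v hv).2]⟩
  suffices h : Intertwines V J y ∧ Intertwines V J (star y) from h.1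
  induction hy using StarAlgebra.adjoin_induction with
  | mem x hx => exact ⟨hs x hx, hs' x hx⟩
  | algebraMap r => exact ⟨hscal r, by rw [← algebraMap_star_comm]; exact hscal _⟩
  | add x y _ _ hx hy => exact ⟨hadd hx.1 hy.1, by rw [star_add]; exact hadd hx.2 hy.2⟩
  | mul x y _ _ hx hy => exact ⟨hmul hx.1 hy.1, by rw [star_mul]; exact hmul hy.2 hx.2⟩
  | star x _ hx => exact ⟨hx.2, by rw [star_star]; exact hx.1⟩

theorem intertwines_fockSpan {I : Finset ℤ} {J x : MF →L[ℂ] MF}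
    (h : ∀ S ⊆ I, x (eS S) ∈ fockSpan I ∧ x (J (eS S)) = J (x (eS S))) :
    Intertwines (fockSpan I) J x := by
  intro v hv
  induction hv using Submodule.span_induction with
  | mem v hv =>
    obtain ⟨S, rfl⟩ := hv
    exact h S (Finset.mem_powerset.1 S.2)
  | zero => simp
  | add v w _ _ hv hw =>
    exact ⟨by simpa using add_mem hv.1 hw.1, by simp [hv.2, hw.2]⟩
  | smul c v _ hv =>
    exact ⟨by simpa using Submodule.smul_mem _ c hv.1, by simp [hv.2]⟩

/-- The extension of `unionIsometry` by zero on the orthogonal complement of `fockSpan I`. -/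
def unionOperator {I E : Finset ℤ} (h : Disjoint I E) : MF →L[ℂ] MF :=
  (unionIsometry h).toContinuousLinearMap ∘L (fockSpan I).orthogonalProjectionOnto

theorem unionOperator_coe {I E : Finset ℤ} (h : Disjoint I E) (v : fockSpan I) :
    unionOperator h v = unionIsometry h v := by
  simp [unionOperator]

theorem unionOperator_eS {I E S : Finset ℤ} (h : Disjoint I E) (hS : S ⊆ I) :
    unionOperator h (eS S) = eS (S ∪ E) :=
  (unionOperator_coe h ⟨_, eS_mem_fockSpan hS⟩).trans (unionIsometry_apply h hS)

theorem IsMonotoneAnnihilation.intertwines {a : ℤ → MF →L[ℂ] MF}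
    (ha : IsMonotoneAnnihilation a) {I E : Finset ℤ} (h : Disjoint I E)
    (hIE : ∀ i ∈ I, ∀ j ∈ E, i < j) {i : ℤ} (hi : i ∈ I) :
    Intertwines (fockSpan I) (unionOperator h) (a i) := by
  refine intertwines_fockSpan fun S hS => ?_
  have hiE : i ∉ E := Finset.disjoint_left.1 h hi
  rw [unionOperator_eS h hS, ha.apply_eS, ha.apply_eS]
  have hiff : (i ∈ S ∪ E ∧ ∀ j ∈ S ∪ E, i ≤ j) ↔ (i ∈ S ∧ ∀ j ∈ S, i ≤ j) := by
    simp only [Finset.mem_union, or_imp, forall_and, hiE, or_false]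
    exact ⟨fun H => ⟨H.1, H.2.1⟩, fun H => ⟨H.1, H.2, fun j hj => (hIE i hi j hj).le⟩⟩
  rw [if_congr hiff rfl rfl]
  split_ifs
  · have hS' := (Finset.erase_subset i S).trans hS
    refine ⟨eS_mem_fockSpan hS', ?_⟩
    rw [unionOperator_eS h hS', Finset.erase_union_distrib, Finset.erase_eq_of_notMem hiE]
  · simp

theorem IsMonotoneAnnihilation.intertwines_star {a : ℤ → MF →L[ℂ] MF}
    (ha : IsMonotoneAnnihilation a) {I E : Finset ℤ} (h : Disjoint I E)
    (hIE : ∀ i ∈ I, ∀ j ∈ E, i < j) {i : ℤ} (hi : i ∈ I) :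
    Intertwines (fockSpan I) (unionOperator h) (star (a i)) := by
  refine intertwines_fockSpan fun S hS => ?_
  rw [unionOperator_eS h hS, ha.star_apply_eS, ha.star_apply_eS]
  have hiff : (∀ j ∈ S ∪ E, i < j) ↔ ∀ j ∈ S, i < j := by
    simp only [Finset.mem_union, or_imp, forall_and]
    exact ⟨And.left, fun H => ⟨H, hIE i hi⟩⟩
  rw [if_congr hiff rfl rfl]
  split_ifs
  · have hS' := Finset.insert_subset hi hS
    refine ⟨eS_mem_fockSpan hS', ?_⟩
    rw [unionOperator_eS h hS', Finset.insert_union]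
  · simp

theorem IsMonotoneAnnihilation.unionIsometry_intertwines {a : ℤ → MF →L[ℂ] MF}
    (ha : IsMonotoneAnnihilation a) {n : ℕ} {E : Finset ℤ}
    (h : Disjoint (Finset.Icc (-(n : ℤ)) n) E)
    (hE : ∀ i ∈ Finset.Icc (-(n : ℤ)) n, ∀ j ∈ E, i < j) {x : MF →L[ℂ] MF} (hx : x ∈ MonMn a n)
    (v : fockSpan (Finset.Icc (-(n : ℤ)) n)) :
    ∃ hv : x v ∈ fockSpan (Finset.Icc (-(n : ℤ)) n),
      x (unionIsometry h v) = unionIsometry h ⟨x v, hv⟩ := by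
  have H : Intertwines (fockSpan (Finset.Icc (-(n : ℤ)) n)) (unionOperator h) x := by
    refine intertwines_of_mem_closure_adjoin (Submodule.closed_of_finiteDimensional _) ?_ ?_ hx
    · rintro _ ⟨i, h₁, h₂, rfl⟩
      exact ha.intertwines h hE (Finset.mem_Icc.2 ⟨h₁, h₂⟩)
    · rintro _ ⟨i, h₁, h₂, rfl⟩
      exact ha.intertwines_star h hE (Finset.mem_Icc.2 ⟨h₁, h₂⟩)
  obtain ⟨hv, hJ⟩ := H v v.2
  exact ⟨hv, by rw [← unionOperator_coe, ← unionOperator_coe, hJ]⟩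

theorem inner_unionIsometry_eq_zero {I E F : Finset ℤ} (hE : Disjoint I E) (hF : Disjoint I F)
    (hEF : E ≠ F) (v w : fockSpan I) : ⟪unionIsometry hE v, unionIsometry hF w⟫_ℂ = 0 := by
  have hv : unionIsometry hE v ∈ (unionIsometry hE).range := ⟨v, rfl⟩
  have hw : unionIsometry hF w ∈ (unionIsometry hF).range := ⟨w, rfl⟩
  rw [range_unionIsometry] at hv hw
  refine Submodule.isOrtho_span.2 ?_ hw _ hv
  rintro _ ⟨T, rfl⟩ _ ⟨S, rfl⟩
  have sdiff_union {S G : Finset ℤ} (hS : S ⊆ I) (hG : Disjoint I G) : (S ∪ G) \ I = G := by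
    rw [Finset.union_sdiff_distrib, Finset.sdiff_eq_empty_iff_subset.2 hS, Finset.empty_union,
      Finset.sdiff_eq_self_of_disjoint hG.symm]
  rw [inner_eS_eS, if_neg]
  intro h
  apply hEF
  rw [← sdiff_union (Finset.mem_powerset.1 S.2) hE, ← h,
    sdiff_union (Finset.mem_powerset.1 T.2) hF]

theorem range_unionIsometry_sup (I : Finset ℤ) {m : ℤ} (hm : Disjoint I {m}) :
    (unionIsometry (Finset.disjoint_empty_right I)).range ⊔ (unionIsometry hm).range =
      fockSpan (insert m I) := by
  rw [range_unionIsometry, range_unionIsometry, ← Submodule.span_union, fockSpan]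
  congr 1
  ext v
  constructor
  · rintro (⟨S, rfl⟩ | ⟨S, rfl⟩)
    · have hS := Finset.mem_powerset.1 S.2
      exact ⟨⟨S, Finset.mem_powerset.2 (hS.trans (Finset.subset_insert m I))⟩, by simp⟩
    · refine ⟨⟨insert m (S : Finset ℤ), Finset.mem_powerset.2 ?_⟩, ?_⟩
      · exact Finset.insert_subset_insert m (Finset.mem_powerset.1 S.2)
      · simp [Finset.union_singleton]
  · rintro ⟨S, rfl⟩
    have hS := Finset.mem_powerset.1 S.2
    by_cases hmS : m ∈ (S : Finset ℤ)
    · refine Or.inr ⟨⟨(S : Finset ℤ).erase m, Finset.mem_powerset.2 ?_⟩, ?_⟩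
      · exact Finset.subset_insert_iff.1 hS
      · simp [Finset.union_singleton, Finset.insert_erase hmS]
    · exact Or.inl ⟨⟨S, Finset.mem_powerset.2 ((Finset.subset_insert_iff_of_notMem hmS).1 hS)⟩,
        by simp⟩

/-- Multiplicity-2 step of the Bratteli diagram: as a representation of `𝔐_n`,
`W_n` is unitarily equivalent to `V_n ⊕ V_n`. -/
theorem stmt14 (a : ℤ → MF →L[ℂ] MF) (ha : IsMonotoneAnnihilation a) (n : ℕ) :
    ∃ K₁ K₂ : Submodule ℂ MF,
      K₁ ≤ Wn n ∧ K₂ ≤ Wn n ∧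
      IsClosed (K₁ : Set MF) ∧ IsClosed (K₂ : Set MF) ∧
      (∀ x ∈ MonMn a n, ∀ v ∈ K₁, x v ∈ K₁) ∧
      (∀ x ∈ MonMn a n, ∀ v ∈ K₂, x v ∈ K₂) ∧
      (∀ v ∈ K₁, ∀ w ∈ K₂, ⟪v, w⟫_ℂ = 0) ∧
      K₁ ⊔ K₂ = Wn n ∧
      (∃ U : ↥(Vn n) ≃ₗᵢ[ℂ] ↥K₁,
        ∀ x, ∀ _ : x ∈ MonMn a n, ∀ ξ : ↥(Vn n), ∀ h : x (ξ : MF) ∈ Vn n,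
          x ((U ξ : MF)) = (U ⟨x (ξ : MF), h⟩ : MF)) ∧
      (∃ U : ↥(Vn n) ≃ₗᵢ[ℂ] ↥K₂,
        ∀ x, ∀ _ : x ∈ MonMn a n, ∀ ξ : ↥(Vn n), ∀ h : x (ξ : MF) ∈ Vn n,
          x ((U ξ : MF)) = (U ⟨x (ξ : MF), h⟩ : MF)) := by
  have hV : Vn n = fockSpan (Finset.Icc (-(n : ℤ)) n) := topologicalClosure_span_eS _
  have hW : Wn n = fockSpan (insert ((n : ℤ) + 1) (Finset.Icc (-(n : ℤ)) n)) := by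
    rw [Finset.insert_Icc_right_eq_Icc_add_one (by omega)]
    exact topologicalClosure_span_eS _
  rw [hV, hW]
  have h₁ := Finset.disjoint_empty_right (Finset.Icc (-(n : ℤ)) n)
  have h₂ : Disjoint (Finset.Icc (-(n : ℤ)) n) {(n : ℤ) + 1} := by simp
  have hx₁ (x) (hx : x ∈ MonMn a n) := ha.unionIsometry_intertwines h₁ (by simp) hx
  have hx₂ (x) (hx : x ∈ MonMn a n) := ha.unionIsometry_intertwines h₂ (by simp) hx
  have hsup := range_unionIsometry_sup (Finset.Icc (-(n : ℤ)) n) h₂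
  refine ⟨_, _, le_sup_left.trans_eq hsup, le_sup_right.trans_eq hsup,
    Submodule.closed_of_finiteDimensional _, Submodule.closed_of_finiteDimensional _,
    ?_, ?_, ?_, hsup, ⟨(unionIsometry h₁).equivRange, fun x hx ξ _ => (hx₁ x hx ξ).2⟩,
    ⟨(unionIsometry h₂).equivRange, fun x hx ξ _ => (hx₂ x hx ξ).2⟩⟩
  · rintro x hx _ ⟨v, rfl⟩
    obtain ⟨hv, h⟩ := hx₁ x hx v
    exact ⟨_, h.symm⟩
  · rintro x hx _ ⟨v, rfl⟩
    obtain ⟨hv, h⟩ := hx₂ x hx v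
    exact ⟨_, h.symm⟩
  · rintro _ ⟨v, rfl⟩ _ ⟨w, rfl⟩
    exact inner_unionIsometry_eq_zero h₁ h₂ (Finset.singleton_ne_empty _).symm v w
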